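/- Let r : ℝ^d → ℝ be differentiable, μ-strongly convex and μ'-smooth, and let η ≥ 0. If u, v, y₁, y₂, g₁, g₂ ∈ ℝ^d satisfy ∇r(u) = ∇r(y₁) − η·g₁ and ∇r(v) = ∇r(y₂) − η·g₂, then ‖u − v‖ ≤ (μ'/μ)·‖y₁ − y₂‖ + (η/μ)·‖g₁ − g₂‖. -/

import Mathlib

open RealInnerProductSpace Finset

/-- `h'` is the gradient of `h` at every point. -/
def HasGradFn {d : ℕ} (h : EuclideanSpace ℝ (Fin d) → ℝ)
    (h' : EuclideanSpace ℝ (Fin d) → EuclideanSpace ℝ (Fin d)) : Prop :=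
  ∀ x, HasGradientAt h (h' x) x

/-- `h` is `c`-strongly convex with gradient `h'`. -/
def StrongConvexGrad {d : ℕ} (c : ℝ) (h : EuclideanSpace ℝ (Fin d) → ℝ)
    (h' : EuclideanSpace ℝ (Fin d) → EuclideanSpace ℝ (Fin d)) : Prop :=
  ∀ x y, h x + ⟪h' x, y - x⟫ + c / 2 * ‖y - x‖ ^ 2 ≤ h y

/-- `h` is `c`-smooth with gradient `h'`. -/
def SmoothGrad {d : ℕ} (c : ℝ) (h : EuclideanSpace ℝ (Fin d) → ℝ)
    (h' : EuclideanSpace ℝ (Fin d) → EuclideanSpace ℝ (Fin d)) : Prop :=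
  ∀ x y, h y ≤ h x + ⟪h' x, y - x⟫ + c / 2 * ‖y - x‖ ^ 2

/-- Bregman divergence `D_r(x, y)` of `r` with gradient `r'`. -/
noncomputable def bregman {d : ℕ} (r : EuclideanSpace ℝ (Fin d) → ℝ)
    (r' : EuclideanSpace ℝ (Fin d) → EuclideanSpace ℝ (Fin d))
    (x y : EuclideanSpace ℝ (Fin d)) : ℝ :=
  r x - r y - ⟪r' y, x - y⟫

section GradientInequalities

variable {d : ℕ} {c L : ℝ} {h : EuclideanSpace ℝ (Fin d) → ℝ}
  {h' : EuclideanSpace ℝ (Fin d) → EuclideanSpace ℝ (Fin d)}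

/-- The gradient of a strongly convex function is expansive with the strong convexity constant. -/
lemma StrongConvexGrad.mul_norm_sub_le (hsc : StrongConvexGrad c h h')
    (x y : EuclideanSpace ℝ (Fin d)) : c * ‖x - y‖ ≤ ‖h' x - h' y‖ := by
  rcases (norm_nonneg (x - y)).eq_or_lt with h0 | hpos
  · simp [← h0]
  have hxy := hsc x y
  have hyx := hsc y x
  rw [← neg_sub x y, inner_neg_right, norm_neg] at hxy
  have hinner := real_inner_le_norm (h' x - h' y) (x - y)
  rw [inner_sub_left] at hinner
  refine le_of_mul_le_mul_right ?_ hpos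
  linarith

/-- The smoothness constant of a strongly convex function on a nontrivial space is at least its
strong convexity constant. -/
lemma StrongConvexGrad.le_of_smoothGrad (hsc : StrongConvexGrad c h h') (hsm : SmoothGrad L h h')
    {x y : EuclideanSpace ℝ (Fin d)} (hxy : x ≠ y) : c ≤ L := by
  have hpos : 0 < ‖y - x‖ ^ 2 := pow_pos (norm_pos_iff.2 (sub_ne_zero.2 hxy.symm)) 2
  have hle := (hsc x y).trans (hsm x y)
  refine le_of_mul_le_mul_right ?_ hpos
  linarith

/-- A convex smooth function exceeds its linearization by a multiple of the squared gradient gap. -/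
lemma SmoothGrad.add_inner_add_sq_le (hsm : SmoothGrad L h h') (hL : 0 < L)
    (hsc : StrongConvexGrad 0 h h') (x y : EuclideanSpace ℝ (Fin d)) :
    h x + ⟪h' x, y - x⟫ + ‖h' y - h' x‖ ^ 2 / (2 * L) ≤ h y := by
  set g := h' y - h' x with hg
  have hlow := hsc x (y - L⁻¹ • g)
  have hup := hsm y (y - L⁻¹ • g)
  rw [sub_sub_cancel_left, inner_neg_right, norm_neg, norm_smul, inner_smul_right, mul_pow,
    Real.norm_eq_abs, sq_abs] at hup
  rw [sub_right_comm, inner_sub_right, inner_smul_right] at hlow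
  have hgg : ⟪h' y, g⟫ - ⟪h' x, g⟫ = ‖g‖ ^ 2 := by
    rw [← inner_sub_left, ← hg, real_inner_self_eq_norm_sq]
  have hcalc : L⁻¹ * ⟪h' y, g⟫ - L⁻¹ * ⟪h' x, g⟫ - L / 2 * (L⁻¹ ^ 2 * ‖g‖ ^ 2)
      = ‖g‖ ^ 2 / (2 * L) := by
    rw [← mul_sub, hgg]
    field_simp
    ring
  linarith

/-- The gradient of a convex smooth function is Lipschitz with the smoothness constant. -/
lemma SmoothGrad.norm_sub_le (hsm : SmoothGrad L h h') (hL : 0 < L)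
    (hsc : StrongConvexGrad 0 h h') (x y : EuclideanSpace ℝ (Fin d)) :
    ‖h' x - h' y‖ ≤ L * ‖x - y‖ := by
  rcases (norm_nonneg (h' x - h' y)).eq_or_lt with h0 | hpos
  · rw [← h0]
    positivity
  have hxy := hsm.add_inner_add_sq_le hL hsc x y
  have hyx := hsm.add_inner_add_sq_le hL hsc y x
  rw [← neg_sub x y, inner_neg_right, norm_sub_rev] at hxy
  have hinner := real_inner_le_norm (h' x - h' y) (x - y)
  rw [inner_sub_left] at hinner
  have hsq : ‖h' x - h' y‖ ^ 2 / L ≤ ‖h' x - h' y‖ * ‖x - y‖ := by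
    have hhalf : ‖h' x - h' y‖ ^ 2 / L = 2 * (‖h' x - h' y‖ ^ 2 / (2 * L)) := by
      field_simp
    linarith
  rw [div_le_iff₀ hL] at hsq
  refine le_of_mul_le_mul_left ?_ hpos
  linarith

end GradientInequalities

/-- The perturbation bound (equations (21)–(22)) used in the proof of Theorem 1
to bound the network error `Δ_t`. -/
theorem mirror_map_perturbation_bound
    {d : ℕ} (r : EuclideanSpace ℝ (Fin d) → ℝ)
    (r' : EuclideanSpace ℝ (Fin d) → EuclideanSpace ℝ (Fin d))
    (hrdiff : HasGradFn r r')
    (mu mu' eta : ℝ) (hmu : 0 < mu)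
    (hrsc : StrongConvexGrad mu r r') (hrsm : SmoothGrad mu' r r')
    (heta : 0 ≤ eta)
    (u v y₁ y₂ g₁ g₂ : EuclideanSpace ℝ (Fin d))
    (hu : r' u = r' y₁ - eta • g₁) (hv : r' v = r' y₂ - eta • g₂) :
    ‖u - v‖ ≤ mu' / mu * ‖y₁ - y₂‖ + eta / mu * ‖g₁ - g₂‖ := by
  have hlip : ‖r' y₁ - r' y₂‖ ≤ mu' * ‖y₁ - y₂‖ := by
    rcases eq_or_ne y₁ y₂ with rfl | hne
    · simp
    have hconv : StrongConvexGrad 0 r r' := fun x y => by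
      have hsq : 0 ≤ mu / 2 * ‖y - x‖ ^ 2 := by positivity
      linarith [hrsc x y]
    exact hrsm.norm_sub_le (hmu.trans_le (hrsc.le_of_smoothGrad hrsm hne)) hconv y₁ y₂
  have hdiff : r' u - r' v = (r' y₁ - r' y₂) - eta • (g₁ - g₂) := by
    rw [hu, hv, smul_sub]
    abel
  have htri : ‖r' u - r' v‖ ≤ ‖r' y₁ - r' y₂‖ + eta * ‖g₁ - g₂‖ := by
    rw [hdiff]
    refine (norm_sub_le _ _).trans_eq ?_
    rw [norm_smul, Real.norm_of_nonneg heta]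
  have hexp := hrsc.mul_norm_sub_le u v
  rw [div_mul_eq_mul_div, div_mul_eq_mul_div, ← add_div, le_div_iff₀' hmu]
  linarith
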